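/- arXiv:1803.04005 — 2 statements merged into one kernel-verified Lean document; each statement's English description precedes it below -/
import Mathlib

section
/- Let n ≥ 2, d ≥ 3, and let f_1, …, f_n ∈ ℂ[z_1,…,z_n] be homogeneous forms of degree d−1 whose only common zero in ℂ^n is the origin. Then in the algebra M_𝔣 := ℂ[z_1,…,z_n]/(f_1,…,f_n), the socle Soc(M_𝔣) := {x ∈ M_𝔣 : x·𝔪 = 0}, where 𝔪 is the maximal ideal generated by the classes of z_1,…,z_n, is a one-dimensional ℂ-vector space spanned by the class of the Jacobian Jac(𝔣) := det(∂f_i/∂z_j); in particular Jac(𝔣) ∉ (f_1,…,f_n). -/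
open MvPolynomial

open scoped Matrix TensorProduct

section Cramer

variable {ι R : Type*} [Fintype ι] [DecidableEq ι] [CommRing R]

/-- Cramer's rule: `det M` multiplies the ideal generated by the coordinates of `v` into any ideal
containing the coordinates of `M v`. -/
theorem Matrix.det_mul_mem_of_mulVec_mem {J : Ideal R} {M : Matrix ι ι R} {v : ι → R}
    (h : ∀ i, (M *ᵥ v) i ∈ J) {p : R} (hp : p ∈ Ideal.span (Set.range v)) : M.det * p ∈ J := by
  have key : M.adjugate *ᵥ (M *ᵥ v) = M.det • v := by
    rw [Matrix.mulVec_mulVec, Matrix.adjugate_mul, Matrix.smul_mulVec, Matrix.one_mulVec]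
  obtain ⟨c, rfl⟩ := Ideal.mem_span_range_iff_exists_fun.mp hp
  rw [Finset.mul_sum]
  refine J.sum_mem fun i _ => ?_
  have hi : (M.adjugate *ᵥ (M *ᵥ v)) i = M.det * v i := by rw [key]; rfl
  rw [mul_left_comm, ← hi]
  exact J.mul_mem_left _ (J.sum_mem fun j _ => J.mul_mem_left _ (h j))

end Cramer

namespace MvPolynomial

section PurePowers

variable {ι R : Type*} [CommRing R]

theorem mem_span_X_pow_image_iff {N : ℕ} {s : Set ι} {p : MvPolynomial ι R} :
    p ∈ Ideal.span ((fun i => (X i : MvPolynomial ι R) ^ N) '' s) ↔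
      ∀ m ∈ p.support, ∃ i ∈ s, N ≤ m i := by
  have : (fun i => (X i : MvPolynomial ι R) ^ N) '' s =
      (fun m => monomial m (1 : R)) '' ((fun i => Finsupp.single i N) '' s) := by
    rw [Set.image_image]
    simp only [X_pow_eq_monomial]
  rw [this, mem_ideal_span_monomial_image]
  simp

/-- A variable is a nonzerodivisor modulo powers of the other variables. -/
theorem mem_span_X_pow_of_mul_X_mem {N : ℕ} {s : Set ι} {i : ι} (hi : i ∉ s)
    {p : MvPolynomial ι R}
    (h : p * X i ∈ Ideal.span ((fun i => (X i : MvPolynomial ι R) ^ N) '' s)) :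
    p ∈ Ideal.span ((fun i => (X i : MvPolynomial ι R) ^ N) '' s) := by
  rw [mem_span_X_pow_image_iff] at h ⊢
  intro m hm
  obtain ⟨j, hj, hN⟩ := h (m + Finsupp.single i 1) (by
    rw [mem_support_iff, coeff_mul_X]
    exact mem_support_iff.mp hm)
  have hij : i ≠ j := fun e => hi (e ▸ hj)
  exact ⟨j, hj, by simpa [Finsupp.single_apply, hij] using hN⟩

variable [Fintype ι] [DecidableEq ι]

theorem det_sub_det_mem_span_X_pow {N : ℕ} {M M' : Matrix ι ι (MvPolynomial ι R)}
    (h : M *ᵥ X = fun i => X i ^ N) (h' : M' *ᵥ X = fun i => X i ^ N) :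
    M'.det - M.det ∈ Ideal.span (Set.range fun i => (X i : MvPolynomial ι R) ^ N) := by
  suffices H : ∀ (s : Finset ι) (M' : Matrix ι ι (MvPolynomial ι R)),
      (∀ i, M' i ⬝ᵥ X = X i ^ N) → (∀ i ∉ s, M' i = M i) → M'.det - M.det ∈
        Ideal.span (Set.range fun i => (X i : MvPolynomial ι R) ^ N) from
    H Finset.univ M' (congrFun h') fun i hi => absurd (Finset.mem_univ i) hi
  have hM : ∀ i, M i ⬝ᵥ X = X i ^ N := congrFun h
  clear h'
  intro s
  induction s using Finset.induction_on with
  | empty =>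
    intro M' _ hs
    have : M' = M := _root_.funext fun i => hs i (Finset.notMem_empty i)
    simp [this]
  | insert i s hi ih =>
    intro M' hM' hs
    have ih' := ih (M'.updateRow i (M i))
      (fun j => by
        by_cases hj : j = i
        · subst hj
          rw [Matrix.updateRow_self]
          exact hM j
        · rw [Matrix.updateRow_ne hj]
          exact hM' j)
      (fun j hj => by
        by_cases hji : j = i
        · subst hji
          rw [Matrix.updateRow_self]
        · rw [Matrix.updateRow_ne hji]
          exact hs j (by simp [hji, hj]))
    have hdiff : M'.det =
        (M'.updateRow i (M i)).det + (M'.updateRow i (M' i - M i)).det := by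
      rw [← Matrix.det_updateRow_add, add_sub_cancel, Matrix.updateRow_eq_self]
    have hmem : (M'.updateRow i (M' i - M i)).det ∈
        Ideal.span ((fun i => (X i : MvPolynomial ι R) ^ N) '' {i}ᶜ) := by
      refine mem_span_X_pow_of_mul_X_mem (i := i) (by simp)
        (Matrix.det_mul_mem_of_mulVec_mem (fun j => ?_) (Ideal.subset_span ⟨i, rfl⟩))
      change Matrix.updateRow M' i (M' i - M i) j ⬝ᵥ X ∈ _
      by_cases hj : j = i
      · subst hj
        rw [Matrix.updateRow_self, sub_dotProduct, hM', hM, sub_self]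
        exact zero_mem _
      · rw [Matrix.updateRow_ne hj, hM']
        exact Ideal.subset_span ⟨j, hj, rfl⟩
    rw [hdiff, add_sub_right_comm]
    exact add_mem ih' (Ideal.span_mono (Set.image_subset_range _ _) hmem)

theorem prod_X_pow_notMem_span_X_pow [Nontrivial R] (N : ℕ) :
    (∏ i, (X i : MvPolynomial ι R) ^ N) ∉
      Ideal.span (Set.range fun i => (X i : MvPolynomial ι R) ^ (N + 1)) := by
  rw [← Set.image_univ, mem_span_X_pow_image_iff]
  intro h
  have hprod : (∏ i, (X i : MvPolynomial ι R) ^ N) =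
      monomial (Finsupp.equivFunOnFinite.symm fun _ => N) 1 := by
    rw [monomial_eq, C_1, one_mul, Finsupp.prod_fintype _ _ (by simp)]
    simp
  obtain ⟨i, -, hi⟩ := h (Finsupp.equivFunOnFinite.symm fun _ => N) (by
    rw [mem_support_iff, hprod, coeff_monomial, if_pos rfl]
    exact one_ne_zero)
  simp at hi

/-- If the forms `f = C X` generate an ideal containing a power of each variable, then `det C`
does not lie in that ideal. -/
theorem det_notMem_span_of_mulVec_X_eq [Nontrivial R] {f : ι → MvPolynomial ι R}
    (hrad : ∀ i, X i ∈ (Ideal.span (Set.range f)).radical)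
    {C : Matrix ι ι (MvPolynomial ι R)} (hC : C *ᵥ X = f) :
    C.det ∉ Ideal.span (Set.range f) := by
  intro hdet
  choose k hk using hrad
  set N := ∑ i, k i
  have hpow : ∀ i, (X i : MvPolynomial ι R) ^ (N + 1) ∈ Ideal.span (Set.range f) := fun i =>
    Ideal.pow_mem_of_pow_mem _ (hk i)
      ((Finset.single_le_sum (fun j _ => Nat.zero_le (k j)) (Finset.mem_univ i)).trans
        (Nat.le_succ N))
  choose B hB using fun i => Ideal.mem_span_range_iff_exists_fun.mp (hpow i)
  have hBf : Matrix.of B *ᵥ f = fun i => X i ^ (N + 1) := _root_.funext hB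
  have hBC : (Matrix.of B * C) *ᵥ X = fun i => X i ^ (N + 1) := by
    rw [← Matrix.mulVec_mulVec, hC, hBf]
  have hdiag : Matrix.diagonal (fun i => (X i : MvPolynomial ι R) ^ N) *ᵥ X =
      fun i => X i ^ (N + 1) := by
    ext1 i
    rw [Matrix.mulVec_diagonal, pow_succ]
  have hsub := det_sub_det_mem_span_X_pow hBC hdiag
  rw [Matrix.det_diagonal, Matrix.det_mul] at hsub
  have hmul : (Matrix.of B).det * C.det ∈
      Ideal.span (Set.range fun i => (X i : MvPolynomial ι R) ^ (N + 1)) :=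
    Matrix.det_mul_mem_of_mulVec_mem (fun i => by
      rw [hBf]
      exact Ideal.subset_span ⟨i, rfl⟩) hdet
  exact prod_X_pow_notMem_span_X_pow N ((Submodule.sub_mem_iff_left _ hmul).mp hsub)

end PurePowers

section Bezoutian

variable {ι K : Type*} [Field K]

theorem tmul_one_sub_one_tmul_mem_span (p : MvPolynomial ι K) :
    p ⊗ₜ[K] 1 - 1 ⊗ₜ[K] p ∈ Ideal.span (Set.range fun i : ι =>
      (X i : MvPolynomial ι K) ⊗ₜ[K] (1 : MvPolynomial ι K) - 1 ⊗ₜ[K] X i) := by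
  set D := Ideal.span (Set.range fun i : ι =>
      (X i : MvPolynomial ι K) ⊗ₜ[K] (1 : MvPolynomial ι K) - 1 ⊗ₜ[K] X i)
  have h : (Ideal.Quotient.mkₐ K D).comp Algebra.TensorProduct.includeLeft =
      (Ideal.Quotient.mkₐ K D).comp Algebra.TensorProduct.includeRight :=
    algHom_ext fun i => Ideal.Quotient.eq.mpr (Ideal.subset_span ⟨i, rfl⟩)
  exact Ideal.Quotient.eq.mp (DFunLike.congr_fun h p)

/-- Evaluating the left tensor factor at the origin. -/
noncomputable def evalZeroLeft (ι K : Type*) [Field K] :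
    MvPolynomial ι K ⊗[K] MvPolynomial ι K →ₐ[K] MvPolynomial ι K :=
  Algebra.TensorProduct.lift ((Algebra.ofId K _).comp (aeval 0)) (AlgHom.id K _)
    fun _ _ => Commute.all _ _

/-- Evaluating the right tensor factor at the origin. -/
noncomputable def evalZeroRight (ι K : Type*) [Field K] :
    MvPolynomial ι K ⊗[K] MvPolynomial ι K →ₐ[K] MvPolynomial ι K :=
  Algebra.TensorProduct.lift (AlgHom.id K _) ((Algebra.ofId K _).comp (aeval 0))
    fun _ _ => Commute.all _ _

theorem evalZeroLeft_tmul (p q : MvPolynomial ι K) :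
    evalZeroLeft ι K (p ⊗ₜ q) = constantCoeff p • q := by
  simp [evalZeroLeft, Algebra.ofId_apply, Algebra.smul_def]

theorem evalZeroRight_tmul (p q : MvPolynomial ι K) :
    evalZeroRight ι K (p ⊗ₜ q) = constantCoeff q • p := by
  simp [evalZeroRight, Algebra.ofId_apply, Algebra.smul_def, mul_comm]

variable {A : Type*} [CommRing A] [Algebra K A]

/-- An element killed by all variables is multiplied by a polynomial through the constant
coefficient of the latter. -/
theorem mul_map_eq_constantCoeff_smul {π : MvPolynomial ι K →ₐ[K] A} {x : A}
    (hx : ∀ i, x * π (X i) = 0) (p : MvPolynomial ι K) :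
    x * π p = constantCoeff p • x := by
  induction p using MvPolynomial.induction_on with
  | C a => rw [constantCoeff_C, Algebra.smul_def, mul_comm, algHom_C]
  | add p q hp hq => rw [map_add, mul_add, hp, hq, map_add, add_smul]
  | mul_X p i _ => simp [mul_left_comm x, hx i]

/-- The socle of a complete intersection supported at the origin is at most one-dimensional. -/
theorem exists_eq_smul_of_mul_X_eq_zero [Fintype ι] [DecidableEq ι]
    {f : ι → MvPolynomial ι K} (hf : ∀ i, constantCoeff (f i) = 0)
    (hrad : ∀ i, X i ∈ (Ideal.span (Set.range f)).radical)
    {π : MvPolynomial ι K →ₐ[K] A} (hsurj : Function.Surjective π)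
    (hπ : RingHom.ker π = Ideal.span (Set.range f)) :
    ∃ e : A, ∀ x : A, (∀ i, x * π (X i) = 0) → ∃ c : K, x = c • e := by
  choose Δ hΔ using fun i =>
    Ideal.mem_span_range_iff_exists_fun.mp (tmul_one_sub_one_tmul_mem_span (f i))
  set E := (evalZeroLeft ι K) (Matrix.of Δ).det with hE
  set E' := (evalZeroRight ι K) (Matrix.of Δ).det
  have hπE : π E ≠ 0 := by
    rw [Ne, ← RingHom.mem_ker, hπ, hE, AlgHom.map_det]
    refine det_notMem_span_of_mulVec_X_eq hrad (_root_.funext fun i => ?_)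
    have := congrArg (evalZeroLeft ι K) (hΔ i)
    simpa [evalZeroLeft_tmul, hf, Matrix.mulVec, dotProduct] using this
  let ππ := Algebra.TensorProduct.map π π
  have hker : ∀ p : MvPolynomial ι K,
      ππ (Matrix.of Δ).det * ππ (p ⊗ₜ[K] 1 - 1 ⊗ₜ[K] p) = 0 := by
    intro p
    rw [← map_mul, ← RingHom.mem_ker]
    refine Matrix.det_mul_mem_of_mulVec_mem (fun i => ?_) (tmul_one_sub_one_tmul_mem_span p)
    have hfi : π (f i) = 0 := by
      rw [← RingHom.mem_ker, hπ]
      exact Ideal.subset_span ⟨i, rfl⟩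
    rw [RingHom.mem_ker]
    exact (congrArg ππ (hΔ i)).trans (by simp [ππ, hfi])
  have hleft : ∀ x : A, (∀ i, x * π (X i) = 0) →
      ∀ t, (x ⊗ₜ[K] 1) * ππ t = x ⊗ₜ[K] π (evalZeroLeft ι K t) := by
    intro x hx t
    induction t with
    | zero => simp
    | add s t hs ht => simp only [map_add, mul_add, hs, ht, TensorProduct.tmul_add]
    | tmul p q =>
      have : x * π p = constantCoeff p • x := mul_map_eq_constantCoeff_smul hx p
      simp [ππ, evalZeroLeft_tmul, this, TensorProduct.smul_tmul]
  have hright : ∀ x : A, (∀ i, x * π (X i) = 0) →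
      ∀ t, (1 ⊗ₜ[K] x) * ππ t = π (evalZeroRight ι K t) ⊗ₜ[K] x := by
    intro x hx t
    induction t with
    | zero => simp
    | add s t hs ht => simp only [map_add, mul_add, hs, ht, TensorProduct.add_tmul]
    | tmul p q =>
      have : x * π q = constantCoeff q • x := mul_map_eq_constantCoeff_smul hx q
      simp [ππ, evalZeroRight_tmul, this, TensorProduct.smul_tmul]
  obtain ⟨φ, hφ⟩ := Module.Projective.exists_dual_eq_one K hπE
  refine ⟨π E', fun x hx => ⟨φ x, ?_⟩⟩
  obtain ⟨p, rfl⟩ := hsurj x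
  have hswap : π p ⊗ₜ[K] π E = π E' ⊗ₜ[K] π p := by
    have h := hker p
    rw [mul_comm, map_sub, sub_mul, sub_eq_zero] at h
    have h1 := hleft _ hx (Matrix.of Δ).det
    have h2 := hright _ hx (Matrix.of Δ).det
    simp only [ππ, Algebra.TensorProduct.map_tmul, map_one] at h
    exact h1.symm.trans (h.trans h2)
  have := congrArg (TensorProduct.rid K _ ∘ LinearMap.lTensor _ φ) hswap
  simpa [hφ] using this

end Bezoutian

end MvPolynomial

/-- For `n ≥ 2`, `d ≥ 3` and homogeneous forms `f 1, …, f n` of degree `d - 1`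
whose only common zero is the origin, the socle of `M_𝔣 = ℂ[z]/(f_1,…,f_n)` is the
one-dimensional space spanned by the class of the Jacobian `Jac 𝔣 = det (∂f_i/∂z_j)`;
in particular `Jac 𝔣 ∉ (f_1,…,f_n)`. -/
theorem socle_eq_span_jacobian
    (n d : ℕ) (hn : 2 ≤ n) (hd : 3 ≤ d)
    (f : Fin n → MvPolynomial (Fin n) ℂ)
    (hf : ∀ i, (f i).IsHomogeneous (d - 1))
    (hzero : ∀ p : Fin n → ℂ, (∀ i, eval p (f i) = 0) → p = 0) :
    letI I : Ideal (MvPolynomial (Fin n) ℂ) := Ideal.span (Set.range f)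
    letI jacPoly : MvPolynomial (Fin n) ℂ :=
      Matrix.det (Matrix.of fun i j : Fin n => pderiv j (f i))
    letI jac : MvPolynomial (Fin n) ℂ ⧸ I := Ideal.Quotient.mk I jacPoly
    letI m : Ideal (MvPolynomial (Fin n) ℂ ⧸ I) :=
      Ideal.span (Set.range fun i => Ideal.Quotient.mk I (X i))
    ({x : MvPolynomial (Fin n) ℂ ⧸ I | ∀ y ∈ m, x * y = 0}
        = {x : MvPolynomial (Fin n) ℂ ⧸ I | ∃ c : ℂ, x = c • jac})
      ∧ jac ≠ 0 ∧ jacPoly ∉ I := by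
  set I : Ideal (MvPolynomial (Fin n) ℂ) := Ideal.span (Set.range f)
  set jacPoly : MvPolynomial (Fin n) ℂ :=
    Matrix.det (Matrix.of fun i j : Fin n => pderiv j (f i))
  set jac : MvPolynomial (Fin n) ℂ ⧸ I := Ideal.Quotient.mk I jacPoly
  have hd0 : ((d - 1 : ℕ) : ℂ) ≠ 0 := by
    rw [Nat.cast_ne_zero]
    omega
  have hf0 : ∀ i, constantCoeff (f i) = 0 := fun i => (hf i).coeff_eq_zero (by simp; omega)
  have hrad : ∀ i, X i ∈ I.radical := by
    intro i
    rw [← vanishingIdeal_zeroLocus_eq_radical (K := ℂ), mem_vanishingIdeal_iff]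
    intro p hp
    have : p = 0 := hzero p fun j => by
      simpa [aeval_eq_eval] using hp (f j) (Ideal.subset_span ⟨j, rfl⟩)
    simp [this]
  have heuler : (Matrix.of fun i j : Fin n => pderiv j (f i)) *ᵥ X =
      ((d - 1 : ℕ) : ℂ) • f := by
    ext1 i
    have := (hf i).sum_X_mul_pderiv
    simpa [Matrix.mulVec, dotProduct, mul_comm, Nat.cast_smul_eq_nsmul] using this
  have hjac : jacPoly ∉ I := by
    have h := det_notMem_span_of_mulVec_X_eq hrad
      (C := ((d - 1 : ℕ) : ℂ)⁻¹ • Matrix.of fun i j : Fin n => pderiv j (f i))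
      (by rw [Matrix.smul_mulVec, heuler, inv_smul_smul₀ hd0])
    rw [Matrix.det_smul_of_tower] at h
    exact fun hmem => h (Submodule.smul_of_tower_mem I (((d - 1 : ℕ) : ℂ)⁻¹ ^ _) hmem)
  have hjac0 : jac ≠ 0 := fun h => hjac (Ideal.Quotient.eq_zero_iff_mem.mp h)
  have hjacX : ∀ i, jac * Ideal.Quotient.mk I (X i) = 0 := by
    intro i
    rw [← map_mul, Ideal.Quotient.eq_zero_iff_mem]
    refine Matrix.det_mul_mem_of_mulVec_mem (fun j => ?_) (Ideal.subset_span ⟨i, rfl⟩)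
    rw [heuler]
    exact Submodule.smul_of_tower_mem I ((d - 1 : ℕ) : ℂ) (Ideal.subset_span ⟨j, rfl⟩)
  refine ⟨?_, hjac0, hjac⟩
  obtain ⟨e, he⟩ := exists_eq_smul_of_mul_X_eq_zero hf0 hrad
    (Ideal.Quotient.mkₐ_surjective ℂ I) (Ideal.Quotient.mkₐ_ker ℂ I)
  obtain ⟨b, hb⟩ := he jac hjacX
  have hb0 : b ≠ 0 := by
    rintro rfl
    exact hjac0 (by simpa using hb)
  ext x
  constructor
  · intro hx
    obtain ⟨c, rfl⟩ := he x fun i => hx _ (Ideal.subset_span ⟨i, rfl⟩)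
    exact ⟨c * b⁻¹, by rw [hb, smul_smul, inv_mul_cancel_right₀ hb0]⟩
  · rintro ⟨c, rfl⟩ y hy
    obtain ⟨a, rfl⟩ := Ideal.mem_span_range_iff_exists_fun.mp hy
    simp only [smul_mul_assoc, Finset.mul_sum, mul_left_comm jac, hjacX, mul_zero,
      Finset.sum_const_zero, smul_zero]
end

section
/- Let n ≥ 2, d ≥ 3, and let f_1, …, f_n ∈ ℂ[z_1,…,z_n] be homogeneous forms of degree d−1 whose only common zero in ℂ^n is the origin. Then the vector space ℂ[z_1,…,z_n]_{n(d−2)} of homogeneous forms of degree n(d−2) is the direct sum of the subspace W_𝔣 := ℂ[z_1,…,z_n]_{n(d−2)−(d−1)}·f_1 + ⋯ + ℂ[z_1,…,z_n]_{n(d−2)−(d−1)}·f_n and the one-dimensional subspace spanned by the Jacobian Jac(𝔣) := det(∂f_i/∂z_j). In particular, W_𝔣 has codimension 1 in ℂ[z_1,…,z_n]_{n(d−2)}. -/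
open MvPolynomial

section Exchange

variable {S : Type*} [CommRing S]

theorem Ideal.isSMulRegular_quotient_iff {P : Ideal S} {a : S} :
    IsSMulRegular (S ⧸ P) a ↔ ∀ x, a * x ∈ P → x ∈ P :=
  isSMulRegular_quotient_iff_mem_of_smul_mem P a

theorem Ideal.isSMulRegular_quotient_sup_span_swap {P : Ideal S} {a b : S}
    (ha : IsSMulRegular (S ⧸ P) a) (hb : IsSMulRegular (S ⧸ (P ⊔ Ideal.span {a})) b) :
    IsSMulRegular (S ⧸ (P ⊔ Ideal.span {b})) a := by
  rw [Ideal.isSMulRegular_quotient_iff] at *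
  intro x hx
  obtain ⟨p, hp, q, hq, hpq⟩ := Submodule.mem_sup.mp hx
  obtain ⟨q, rfl⟩ := Ideal.mem_span_singleton'.mp hq
  have hbq : b * q ∈ P ⊔ Ideal.span {a} := by
    have : b * q = -p + x * a := by linear_combination hpq
    rw [this]
    exact add_mem (Ideal.mem_sup_left (neg_mem hp))
      (Ideal.mem_sup_right (Ideal.mem_span_singleton'.mpr ⟨x, rfl⟩))
  obtain ⟨p', hp', r, hr, hpr⟩ := Submodule.mem_sup.mp (hb q hbq)
  obtain ⟨r, rfl⟩ := Ideal.mem_span_singleton'.mp hr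
  have hx' : x - r * b ∈ P := by
    refine ha _ ?_
    have : a * (x - r * b) = p + b * p' := by linear_combination -hpq - b * hpr
    rw [this]
    exact add_mem hp (P.mul_mem_left _ hp')
  have : x = (x - r * b) + r * b := by ring
  rw [this]
  exact add_mem (Ideal.mem_sup_left hx')
    (Ideal.mem_sup_right (Ideal.mem_span_singleton'.mpr ⟨r, rfl⟩))

/-- Exchanging one generator `z` for `f` in an ideal `P ⊔ (z)`: if the colon ideal of `P ⊔ (z)`
by `m` is generated modulo `P ⊔ (z)` by `Δ`, and `z * Γ ≡ f * Δ` modulo `P`, then the colon ideal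
of `P ⊔ (f)` by `m` is generated modulo `P ⊔ (f)` by `Γ`. -/
theorem Ideal.colon_exchange {P : Ideal S} {z f Δ Γ : S} {m : Set S} (hz : z ∈ m)
    (hzP : IsSMulRegular (S ⧸ P) z) (hfP : IsSMulRegular (S ⧸ P) f)
    (hΔ : z * Γ - f * Δ ∈ P)
    (hcolon : ∀ g, (∀ y ∈ m, g * y ∈ P ⊔ Ideal.span {z}) →
      g ∈ P ⊔ Ideal.span {z} ⊔ Ideal.span {Δ})
    {g : S} (hg : ∀ y ∈ m, g * y ∈ P ⊔ Ideal.span {f}) :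
    g ∈ P ⊔ Ideal.span {f} ⊔ Ideal.span {Γ} := by
  rw [Ideal.isSMulRegular_quotient_iff] at hzP hfP
  obtain ⟨p, hp, q, hq, hpq⟩ := Submodule.mem_sup.mp (hg z hz)
  obtain ⟨h, rfl⟩ := Ideal.mem_span_singleton'.mp hq
  have hh : h ∈ P ⊔ Ideal.span {z} ⊔ Ideal.span {Δ} := by
    refine hcolon h fun y hy => ?_
    obtain ⟨p₁, hp₁, q₁, hq₁, hpq₁⟩ := Submodule.mem_sup.mp (hg y hy)
    obtain ⟨q, rfl⟩ := Ideal.mem_span_singleton'.mp hq₁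
    have : h * y - q * z ∈ P := by
      refine hfP _ ?_
      have : f * (h * y - q * z) = z * p₁ - y * p := by
        linear_combination y * hpq - z * hpq₁
      rw [this]
      exact sub_mem (P.mul_mem_left _ hp₁) (P.mul_mem_left _ hp)
    have e : h * y = (h * y - q * z) + q * z := by ring
    rw [e]
    exact add_mem (Ideal.mem_sup_left this)
      (Ideal.mem_sup_right (Ideal.mem_span_singleton'.mpr ⟨q, rfl⟩))
  obtain ⟨s, hs, c, hc, hsc⟩ := Submodule.mem_sup.mp hh
  obtain ⟨c, rfl⟩ := Ideal.mem_span_singleton'.mp hc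
  obtain ⟨p₂, hp₂, r, hr, hpr⟩ := Submodule.mem_sup.mp hs
  obtain ⟨r, rfl⟩ := Ideal.mem_span_singleton'.mp hr
  have key : g - r * f - c * Γ ∈ P := by
    refine hzP _ ?_
    have : z * (g - r * f - c * Γ) = p + f * p₂ - c * (z * Γ - f * Δ) := by
      linear_combination -hpq - f * hsc - f * hpr
    rw [this]
    exact sub_mem (add_mem hp (P.mul_mem_left _ hp₂)) (P.mul_mem_left _ hΔ)
  have e : g = (g - r * f - c * Γ) + r * f + c * Γ := by ring
  rw [e]
  exact add_mem (Ideal.mem_sup_left (add_mem (Ideal.mem_sup_left key)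
      (Ideal.mem_sup_right (Ideal.mem_span_singleton'.mpr ⟨r, rfl⟩))))
    (Ideal.mem_sup_right (Ideal.mem_span_singleton'.mpr ⟨c, rfl⟩))

end Exchange

theorem Matrix.det_mul_eq_sum_adjugate_mul {m R : Type*} [CommRing R] [Fintype m] [DecidableEq m]
    (M : Matrix m m R) (v : m → R) (j : m) :
    M.det * v j = ∑ i, M.adjugate j i * M.mulVec v i := by
  have := congrFun (congrArg (fun N => N.mulVec v) M.adjugate_mul) j
  simp only [← Matrix.mulVec_mulVec, Matrix.smul_mulVec, Matrix.one_mulVec, Pi.smul_apply,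
    smul_eq_mul] at this
  exact this.symm

section MixedIdeal

variable {S : Type*} [CommRing S]

/-- The ideal generated by the first `k` members of `F` and the members of `z` indexed by `T`. -/
def mixedIdeal (F z : ℕ → S) (k : ℕ) (T : Set ℕ) : Ideal S :=
  Ideal.span (F '' Set.Iio k) ⊔ Ideal.span (z '' T)

theorem mixedIdeal_zero (F z : ℕ → S) (T : Set ℕ) : mixedIdeal F z 0 T = Ideal.span (z '' T) := by
  simp [mixedIdeal]

theorem mixedIdeal_succ (F z : ℕ → S) (k : ℕ) (T : Set ℕ) :
    mixedIdeal F z (k + 1) T = mixedIdeal F z k T ⊔ Ideal.span {F k} := by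
  have : Set.Iio (k + 1) = insert k (Set.Iio k) := by ext; simp
  rw [mixedIdeal, mixedIdeal, this, Set.image_insert_eq, Ideal.span_insert]
  ac_rfl

theorem mixedIdeal_insert (F z : ℕ → S) (k j : ℕ) (T : Set ℕ) :
    mixedIdeal F z k (insert j T) = mixedIdeal F z k T ⊔ Ideal.span {z j} := by
  rw [mixedIdeal, mixedIdeal, Set.image_insert_eq, Ideal.span_insert]
  ac_rfl

theorem left_mem_mixedIdeal (F z : ℕ → S) {k i : ℕ} (T : Set ℕ) (h : i < k) :
    F i ∈ mixedIdeal F z k T :=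
  Ideal.mem_sup_left (Ideal.subset_span ⟨i, h, rfl⟩)

theorem right_mem_mixedIdeal (F z : ℕ → S) (k : ℕ) {j : ℕ} {T : Set ℕ} (h : j ∈ T) :
    z j ∈ mixedIdeal F z k T :=
  Ideal.mem_sup_right (Ideal.subset_span ⟨j, h, rfl⟩)

theorem mixedIdeal_congr {F G : ℕ → S} (z : ℕ → S) {k : ℕ} (T : Set ℕ)
    (h : ∀ i < k, F i = G i) : mixedIdeal F z k T = mixedIdeal G z k T := by
  rw [mixedIdeal, mixedIdeal, Set.image_congr (s := Set.Iio k) h]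

theorem isSMulRegular_mixedIdeal_right {F z : ℕ → S} {n : ℕ}
    (hz : ∀ T, ∀ j < n, j ∉ T → IsSMulRegular (S ⧸ Ideal.span (z '' T)) (z j)) (k : ℕ)
    (hF : ∀ i < k, ∀ T ⊆ Set.Ioo i n, IsSMulRegular (S ⧸ mixedIdeal F z i T) (F i))
    {T : Set ℕ} (hT : T ⊆ Set.Ico k n) {j : ℕ} (hj : j ∈ Set.Ico k n) (hjT : j ∉ T) :
    IsSMulRegular (S ⧸ mixedIdeal F z k T) (z j) := by
  induction k generalizing T j with
  | zero =>
    rw [mixedIdeal_zero]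
    exact hz T j hj.2 hjT
  | succ k ih =>
    rw [mixedIdeal_succ]
    refine Ideal.isSMulRegular_quotient_sup_span_swap
      (ih (fun i hi => hF i (by omega)) (fun t ht => ?_) ?_ hjT) ?_
    · have := hT ht
      simp only [Set.mem_Ico] at this ⊢
      omega
    · simp only [Set.mem_Ico] at hj ⊢
      omega
    · rw [← mixedIdeal_insert]
      refine hF k (by omega) _ (Set.insert_subset ?_ fun t ht => ?_)
      · simp only [Set.mem_Ico, Set.mem_Ioo] at hj ⊢
        omega
      · have := hT ht
        simp only [Set.mem_Ico, Set.mem_Ioo] at this ⊢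
        omega

theorem mul_det_sub_mul_det_mem_mixedIdeal {F z : ℕ → S} {a : ℕ → ℕ → S} {n k : ℕ} (hk : k < n)
    (hF : ∀ i, F i = ∑ j ∈ Finset.range n, a i j * z j) :
    z k * (Matrix.of fun i j : Fin (k + 1) => a i j).det
      - F k * (Matrix.of fun i j : Fin k => a i j).det ∈ mixedIdeal F z k (Set.Ioo k n) := by
  set M : Matrix (Fin (k + 1)) (Fin (k + 1)) S := Matrix.of fun i j => a i j with hM
  set P := mixedIdeal F z k (Set.Ioo k n)
  set v : Fin (k + 1) → S := fun j => z j with hv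
  have hrow (i : Fin (k + 1)) : (M.mulVec v) i - F i ∈ P := by
    have h1 : (M.mulVec v) i = ∑ j ∈ Finset.range (k + 1), a i j * z j := by
      rw [Finset.sum_range]; rfl
    rw [h1, hF i, ← Finset.sum_range_add_sum_Ico _ (Nat.succ_le_of_lt hk), sub_add_cancel_left]
    refine neg_mem (sum_mem fun j hj => P.mul_mem_left _ (right_mem_mixedIdeal F z k ?_))
    simp only [Finset.mem_Ico, Set.mem_Ioo] at hj ⊢
    omega
  have hdet : M.det * z k = ∑ i, M.adjugate (Fin.last k) i * (M.mulVec v) i := by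
    simpa [hv] using M.det_mul_eq_sum_adjugate_mul v (Fin.last k)
  have hadj : M.adjugate (Fin.last k) (Fin.last k) = (Matrix.of fun i j : Fin k => a i j).det := by
    rw [Matrix.adjugate_fin_succ_eq_det_submatrix, Fin.succAbove_last, ← two_mul,
      Even.neg_one_pow (even_two_mul _), one_mul]
    rfl
  rw [mul_comm, hdet, Fin.sum_univ_castSucc, hadj, add_sub_assoc]
  refine add_mem (sum_mem fun i _ => P.mul_mem_left _ ?_) ?_
  · have := add_mem (hrow i.castSucc) (left_mem_mixedIdeal F z (Set.Ioo k n) i.2)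
    simpa using this
  · rw [mul_comm (F k), ← mul_sub]
    exact P.mul_mem_left _ (by simpa using hrow (Fin.last k))

/-- The colon ideal of `(F 0, …, F (k - 1), z k, …, z (n - 1))` by all the `z j` is generated by the
leading `k × k` minor of a matrix expressing `F` in terms of `z`. -/
theorem mem_mixedIdeal_sup_span_det {F z : ℕ → S} {a : ℕ → ℕ → S} {n : ℕ}
    (hF : ∀ i, F i = ∑ j ∈ Finset.range n, a i j * z j)
    (hz : ∀ T, ∀ j < n, j ∉ T → IsSMulRegular (S ⧸ Ideal.span (z '' T)) (z j))
    (hreg : ∀ i < n, ∀ T ⊆ Set.Ioo i n, IsSMulRegular (S ⧸ mixedIdeal F z i T) (F i))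
    {k : ℕ} (hk : k ≤ n) {g : S}
    (hg : ∀ y ∈ z '' Set.Iio n, g * y ∈ mixedIdeal F z k (Set.Ico k n)) :
    g ∈ mixedIdeal F z k (Set.Ico k n) ⊔
      Ideal.span {(Matrix.of fun i j : Fin k => a i j).det} := by
  induction k generalizing g with
  | zero => simp
  | succ k ih =>
    have h1 : Set.Ico (k + 1) n = Set.Ioo k n := by ext; simp
    have h2 : Set.Ico k n = insert k (Set.Ioo k n) := by ext; simp; omega
    rw [h1, mixedIdeal_succ] at hg ⊢
    rw [h2, mixedIdeal_insert] at ih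
    refine Ideal.colon_exchange (Set.mem_image_of_mem z (show k ∈ Set.Iio n from hk)) ?_ ?_
      (mul_det_sub_mul_det_mem_mixedIdeal hk hF) (fun g => ih (by omega)) hg
    · refine isSMulRegular_mixedIdeal_right hz k (fun i hi => hreg i (by omega)) (fun t ht => ?_)
        ⟨le_rfl, hk⟩ (by simp)
      simp only [Set.mem_Ico, Set.mem_Ioo] at ht ⊢
      omega
    · exact hreg k hk _ subset_rfl

end MixedIdeal

section Generic

variable {K S ι : Type*} [Field K] [Infinite K] [CommRing S] [IsNoetherianRing S] [Algebra K S]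
  [Fintype ι]

/-- A generic linear combination of `f` is regular modulo finitely many ideals, provided the radical
of the ideal generated by `f` contains a regular element for each of them. -/
theorem exists_sum_smul_isSMulRegular (f : ι → S) {Q : Set (Ideal S)} (hQ : Q.Finite)
    (h : ∀ P ∈ Q, ∃ y ∈ (Ideal.span (Set.range f)).radical, IsSMulRegular (S ⧸ P) y) :
    ∃ u : ι → K, ∀ P ∈ Q, IsSMulRegular (S ⧸ P) (∑ i, u i • f i) := by
  classical
  let φ : (ι → K) →ₗ[K] S := Fintype.linearCombination K f
  let V : Ideal S → Submodule K (ι → K) := fun p => (p.restrictScalars K).comap φ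
  have hfin : (⋃ P ∈ Q, associatedPrimes S (S ⧸ P)).Finite :=
    hQ.biUnion fun P _ => associatedPrimes.finite S (S ⧸ P)
  have htop : (⊤ : Submodule K (ι → K)) ∉ hfin.toFinset.image V := by
    intro hmem
    obtain ⟨p, hp, hpV⟩ := Finset.mem_image.mp hmem
    obtain ⟨P, hP, hpP⟩ : ∃ P ∈ Q, p ∈ associatedPrimes S (S ⧸ P) := by simpa using hp
    obtain ⟨y, hy, hreg⟩ := h P hP
    have hle : Ideal.span (Set.range f) ≤ p := by
      rw [Ideal.span_le]
      rintro _ ⟨i, rfl⟩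
      have : Pi.single i 1 ∈ V p := hpV ▸ Submodule.mem_top
      simpa [V, φ] using this
    have hyp : y ∈ p := hpP.isPrime.radical_le_iff.mpr hle hy
    have : y ∈ ⋃ p ∈ associatedPrimes S (S ⧸ P), (p : Set S) := Set.mem_biUnion hpP hyp
    rw [biUnion_associatedPrimes_eq_compl_regular] at this
    exact this hreg
  obtain ⟨u, hu⟩ := (Set.ne_univ_iff_exists_notMem _).mp
    (Subspace.biUnion_ne_univ_of_top_notMem htop)
  refine ⟨u, fun P hP => ?_⟩
  by_contra hreg
  have : ∑ i, u i • f i ∈ ⋃ p ∈ associatedPrimes S (S ⧸ P), (p : Set S) := by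
    rw [biUnion_associatedPrimes_eq_compl_regular]
    exact hreg
  obtain ⟨p, hp, hup⟩ := Set.mem_iUnion₂.mp this
  refine hu (Set.mem_biUnion (x := V p) ?_ ?_)
  · exact Finset.mem_image_of_mem V (hfin.mem_toFinset.mpr (Set.mem_biUnion hP hp))
  · simpa [V, φ, Fintype.linearCombination_apply] using hup

theorem exists_regular_combinations (f : ι → S) (z : ℕ → S) (n : ℕ)
    (hz : ∀ T, ∀ j < n, j ∉ T → IsSMulRegular (S ⧸ Ideal.span (z '' T)) (z j))
    (hrad : ∀ j < n, z j ∈ (Ideal.span (Set.range f)).radical) :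
    ∃ u : ℕ → ι → K, ∀ i < n, ∀ T ⊆ Set.Ioo i n,
      IsSMulRegular (S ⧸ mixedIdeal (fun k => ∑ l, u k l • f l) z i T) (∑ l, u i l • f l) := by
  suffices H : ∀ k ≤ n, ∃ u : ℕ → ι → K, ∀ i < k, ∀ T ⊆ Set.Ioo i n,
      IsSMulRegular (S ⧸ mixedIdeal (fun k => ∑ l, u k l • f l) z i T) (∑ l, u i l • f l) from
    H n le_rfl
  intro k hk
  induction k with
  | zero => exact ⟨0, by simp⟩
  | succ k ih =>
    obtain ⟨u, hu⟩ := ih (by omega)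
    obtain ⟨w, hw⟩ := exists_sum_smul_isSMulRegular (K := K) f
      (Q := mixedIdeal (fun k => ∑ l, u k l • f l) z k '' 𝒫 (Set.Ioo k n))
      ((Set.finite_Ioo k n).finite_subsets.image _) (by
        rintro _ ⟨T, hT, rfl⟩
        refine ⟨z k, hrad k hk, isSMulRegular_mixedIdeal_right hz k hu (fun t ht => ?_)
          ⟨le_rfl, hk⟩ fun hkT => (hT hkT).1.false⟩
        have := hT ht
        simp only [Set.mem_Ico, Set.mem_Ioo] at this ⊢
        omega)
    refine ⟨Function.update u k w, fun i hi T hT => ?_⟩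
    rw [mixedIdeal_congr (G := fun k => ∑ l, u k l • f l) z T fun j hj => by
      simp [Function.update_of_ne (show j ≠ k by omega)]]
    rcases Nat.lt_succ_iff_lt_or_eq.mp hi with h | rfl
    · rw [Function.update_of_ne h.ne]
      exact hu i h T hT
    · rw [Function.update_self]
      exact hw _ ⟨T, hT, rfl⟩

end Generic

section Colon

variable {K : Type*} [Field K]

theorem MvPolynomial.isSMulRegular_quotient_span_X_image {σ : Type*} {T : Set σ} {j : σ}
    (hj : j ∉ T) :
    IsSMulRegular (MvPolynomial σ K ⧸ Ideal.span (X '' T : Set (MvPolynomial σ K)))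
      (X j : MvPolynomial σ K) := by
  classical
  rw [Ideal.isSMulRegular_quotient_iff]
  intro x hx
  rw [mem_ideal_span_X_image] at hx ⊢
  intro m hm
  obtain ⟨i, hi, hmi⟩ := hx (m + Finsupp.single j 1) (by
    rw [mem_support_iff, mul_comm, coeff_mul_X]
    exact mem_support_iff.mp hm)
  refine ⟨i, hi, ?_⟩
  have hij : j ≠ i := fun h => hj (h ▸ hi)
  simpa [Finsupp.single_apply, hij] using hmi

theorem det_ne_zero_of_isSMulRegular_mixedIdeal {n : ℕ} {S : Type*} [CommRing S] [Algebra K S]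
    {f : Fin n → S} {z : ℕ → S} {J : Ideal S} (hJ : J ≠ ⊤) (hf : ∀ i, f i ∈ J)
    {u : ℕ → Fin n → K}
    (hu : ∀ i < n, IsSMulRegular (S ⧸ mixedIdeal (fun k => ∑ l, u k l • f l) z i ∅)
      (∑ l, u i l • f l)) :
    (Matrix.of fun i j : Fin n => u i j).det ≠ 0 := by
  classical
  set F : ℕ → S := fun k => ∑ l, u k l • f l with hF
  intro hdet
  obtain ⟨v, hv, hvU⟩ := Matrix.exists_vecMul_eq_zero_iff.mpr hdet
  obtain ⟨i₀, hi₀⟩ := Function.ne_iff.mp hv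
  obtain ⟨k, hk, hmax⟩ := (Finset.univ.filter fun i => v i ≠ 0).exists_max_image id
    ⟨i₀, by simpa using hi₀⟩
  have hvk : v k ≠ 0 := by simpa using hk
  have hsum : ∑ i : Fin n, v i • F i = 0 := by
    have hcol (l : Fin n) : ∑ i : Fin n, v i * u i l = 0 := by
      simpa [Matrix.vecMul, dotProduct] using congrFun hvU l
    simp only [hF, Finset.smul_sum, smul_smul]
    rw [Finset.sum_comm]
    simp [← Finset.sum_smul, hcol]
  have hFk : F k ∈ mixedIdeal F z k ∅ := by
    have hrest : ∑ i ∈ Finset.univ.erase k, v i • F i ∈ mixedIdeal F z k ∅ := by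
      refine sum_mem fun i hi => ?_
      by_cases hvi : v i = 0
      · simp [hvi]
      · have hle : i ≤ k := hmax i (by simpa using hvi)
        have hlt : (i : ℕ) < k := Fin.lt_def.mp (lt_of_le_of_ne hle (Finset.ne_of_mem_erase hi))
        exact Submodule.smul_of_tower_mem _ _ (left_mem_mixedIdeal F z ∅ hlt)
    rw [← Finset.add_sum_erase _ _ (Finset.mem_univ k)] at hsum
    have : F k = -((v k)⁻¹ • ∑ i ∈ Finset.univ.erase k, v i • F i) := by
      rw [eq_neg_of_add_eq_zero_right hsum, smul_neg, neg_neg, smul_smul, inv_mul_cancel₀ hvk,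
        one_smul]
    rw [this]
    exact neg_mem (Submodule.smul_of_tower_mem _ _ hrest)
  have hone : (1 : S) ∈ mixedIdeal F z k ∅ :=
    Ideal.isSMulRegular_quotient_iff.mp (hu k k.2) 1 (by simpa using hFk)
  have hle : mixedIdeal F z k ∅ ≤ J := by
    rw [mixedIdeal, Set.image_empty, Ideal.span_empty, sup_bot_eq, Ideal.span_le]
    rintro _ ⟨i, -, rfl⟩
    exact sum_mem fun l _ => Submodule.smul_of_tower_mem _ _ (hf l)
  exact hJ ((Ideal.eq_top_iff_one J).mpr (hle hone))

/-- If `f = A X` generates an ideal whose radical contains all variables, then the socle modulo `f`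
is generated by `det A`. -/
theorem MvPolynomial.mem_span_sup_span_det_of_mul_X_mem [Infinite K] {n : ℕ}
    (A : Matrix (Fin n) (Fin n) (MvPolynomial (Fin n) K))
    (hrad : ∀ j, X j ∈ (Ideal.span (Set.range (A.mulVec X))).radical)
    {g : MvPolynomial (Fin n) K} (hg : ∀ j, g * X j ∈ Ideal.span (Set.range (A.mulVec X))) :
    g ∈ Ideal.span (Set.range (A.mulVec X)) ⊔ Ideal.span {A.det} := by
  classical
  set f := A.mulVec X with hf
  let z : ℕ → MvPolynomial (Fin n) K := fun j => if h : j < n then X ⟨j, h⟩ else 0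
  have hzX (j : Fin n) : z j = X j := by simp [z]
  have hz (T : Set ℕ) (j : ℕ) (hj : j < n) (hjT : j ∉ T) :
      IsSMulRegular (MvPolynomial (Fin n) K ⧸ Ideal.span (z '' T)) (z j) := by
    have : Ideal.span (z '' T) = Ideal.span (X '' {i : Fin n | (i : ℕ) ∈ T}) := by
      refine le_antisymm (Ideal.span_le.mpr ?_) (Ideal.span_mono ?_)
      · rintro _ ⟨t, ht, rfl⟩
        by_cases h : t < n
        · exact Ideal.subset_span ⟨⟨t, h⟩, ht, (hzX ⟨t, h⟩).symm⟩
        · simp [z, h]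
      · rintro _ ⟨i, hi, rfl⟩
        exact ⟨i, hi, hzX i⟩
    rw [this, hzX ⟨j, hj⟩]
    exact isSMulRegular_quotient_span_X_image hjT
  obtain ⟨u, hu⟩ := exists_regular_combinations (K := K) f z n hz fun j hj => by
    rw [hzX ⟨j, hj⟩]; exact hrad _
  set F : ℕ → MvPolynomial (Fin n) K := fun k => ∑ l, u k l • f l with hF
  let U : Matrix (Fin n) (Fin n) K := Matrix.of fun i l => u i l
  have hU : U.det ≠ 0 := by
    refine det_ne_zero_of_isSMulRegular_mixedIdeal (f := f) (z := z)
      (J := RingHom.ker (constantCoeff (R := K) (σ := Fin n))) (RingHom.ker_ne_top _)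
      (fun i => ?_) fun i hi => hu i hi ∅ (Set.empty_subset _)
    simp [hf, Matrix.mulVec, dotProduct, RingHom.mem_ker]
  have hfF (l : Fin n) : f l = ∑ i : Fin n, U⁻¹ l i • F i := by
    have hinv (m : Fin n) : ∑ i : Fin n, U⁻¹ l i * u i m = (1 : Matrix (Fin n) (Fin n) K) l m := by
      rw [← Matrix.nonsing_inv_mul U (isUnit_iff_ne_zero.mpr hU), Matrix.mul_apply]
      rfl
    simp only [hF, Finset.smul_sum, smul_smul]
    rw [Finset.sum_comm]
    simp [← Finset.sum_smul, hinv, Matrix.one_apply]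
  have hideal : mixedIdeal F z n (Set.Ico n n) = Ideal.span (Set.range f) := by
    rw [mixedIdeal, Set.Ico_self, Set.image_empty, Ideal.span_empty, sup_bot_eq]
    refine le_antisymm (Ideal.span_le.mpr ?_) (Ideal.span_le.mpr ?_)
    · rintro _ ⟨i, -, rfl⟩
      exact sum_mem fun l _ => Submodule.smul_of_tower_mem _ _ (Ideal.subset_span ⟨l, rfl⟩)
    · rintro _ ⟨l, rfl⟩
      rw [hfF]
      exact sum_mem fun i _ => Submodule.smul_of_tower_mem _ _ (Ideal.subset_span ⟨i, i.2, rfl⟩)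
  let a : ℕ → ℕ → MvPolynomial (Fin n) K :=
    fun i j => if h : j < n then ∑ l, u i l • A l ⟨j, h⟩ else 0
  have hFa (i : ℕ) : F i = ∑ j ∈ Finset.range n, a i j * z j := by
    rw [Finset.sum_range]
    simp only [hF, hf, a, z, Fin.is_lt, dite_true, Matrix.mulVec, dotProduct, Finset.smul_sum,
      Finset.sum_mul, smul_mul_assoc]
    rw [Finset.sum_comm]
  have hdet : (Matrix.of fun i j : Fin n => a i j).det = C U.det * A.det := by
    have : (Matrix.of fun i j : Fin n => a i j) = (C (σ := Fin n)).mapMatrix U * A := by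
      ext1 i j
      simp [a, U, Matrix.mul_apply, smul_eq_C_mul]
    rw [this, Matrix.det_mul, RingHom.map_det]
  have key := mem_mixedIdeal_sup_span_det hFa hz hu le_rfl (g := g) (by
    rintro _ ⟨j, hj, rfl⟩
    rw [hideal, hzX ⟨j, hj⟩]
    exact hg _)
  rw [hideal, hdet] at key
  have hle : Ideal.span {C U.det * A.det} ≤ Ideal.span {A.det} :=
    Ideal.span_singleton_le_span_singleton.mpr (dvd_mul_left _ _)
  exact (sup_le_sup_left hle (Ideal.span (Set.range f)) :) key

end Colon

section Homogeneous

variable {K : Type*} [Field K] {n e : ℕ} {A : Matrix (Fin n) (Fin n) (MvPolynomial (Fin n) K)}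

theorem MvPolynomial.homogeneousComponent_mul_of_isHomogeneous {σ R : Type*} [CommSemiring R]
    (p : MvPolynomial σ R) {q : MvPolynomial σ R} {i : ℕ} (hq : q.IsHomogeneous i) (k : ℕ) :
    homogeneousComponent k (p * q) =
      if i ≤ k then homogeneousComponent (k - i) p * q else 0 := by
  let := gradedAlgebra (σ := σ) (R := R)
  have := DirectSum.coe_decompose_mul_of_right_mem (homogeneousSubmodule σ R) (a := p) k
    ((mem_homogeneousSubmodule i q).mpr hq)
  have hcomp (p : MvPolynomial σ R) (k : ℕ) :
      (DirectSum.decompose (homogeneousSubmodule σ R) p k : MvPolynomial σ R) =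
        homogeneousComponent k p :=
    decomposition.decompose'_apply p k
  simpa only [hcomp] using this

theorem MvPolynomial.homogeneousComponent_mem_span_range {σ ι R : Type*} [CommSemiring R]
    {f : ι → MvPolynomial σ R} {r : ℕ} (hf : ∀ i, (f i).IsHomogeneous r)
    {p : MvPolynomial σ R} (hp : p ∈ Ideal.span (Set.range f)) (k : ℕ) :
    homogeneousComponent k p ∈ Ideal.span (Set.range f) := by
  let := gradedAlgebra (σ := σ) (R := R)
  refine homogeneousComponent_mem_of_mem (Ideal.homogeneous_span _ _ ?_) hp k
  rintro _ ⟨i, rfl⟩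
  exact ⟨r, hf i⟩

theorem MvPolynomial.IsHomogeneous.det {σ m R : Type*} [CommRing R] [Fintype m] [DecidableEq m]
    {M : Matrix m m (MvPolynomial σ R)} {r : ℕ} (hM : ∀ i j, (M i j).IsHomogeneous r) :
    M.det.IsHomogeneous (Fintype.card m * r) := by
  rw [Matrix.det_apply]
  refine IsHomogeneous.sum _ _ _ fun τ _ => ?_
  have hprod : (∏ i, M (τ i) i).IsHomogeneous (Fintype.card m * r) := by
    simpa using IsHomogeneous.prod Finset.univ (fun i => M (τ i) i) (fun _ => r)
      fun i _ => hM (τ i) i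
  rcases Int.units_eq_one_or (Equiv.Perm.sign τ) with h | h
  · simpa [h] using hprod
  · simpa [h] using hprod.neg

theorem MvPolynomial.isHomogeneous_mulVec_X (hA : ∀ i j, (A i j).IsHomogeneous e) (i : Fin n) :
    (A.mulVec X i).IsHomogeneous (e + 1) :=
  IsHomogeneous.sum _ _ _ fun j _ => (hA i j).mul (isHomogeneous_X K j)

theorem Matrix.det_mul_mem_span_range_mulVec {m R : Type*} [CommRing R] [Fintype m] [DecidableEq m]
    (M : Matrix m m R) (v : m → R) (j : m) :
    M.det * v j ∈ Ideal.span (Set.range (M.mulVec v)) := by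
  rw [M.det_mul_eq_sum_adjugate_mul]
  exact sum_mem fun i _ => Ideal.mul_mem_left _ _ (Ideal.subset_span ⟨i, rfl⟩)

theorem MvPolynomial.IsHomogeneous.mem_idealOfVars_pow {σ : Type*} {p : MvPolynomial σ K} {k : ℕ}
    (hp : p.IsHomogeneous k) : p ∈ idealOfVars σ K ^ k := by
  rw [mem_pow_idealOfVars_iff']
  exact fun x hx => hp.coeff_eq_zero hx.ne

variable [Infinite K]

theorem MvPolynomial.exists_sub_C_mul_det_mem (hA : ∀ i j, (A i j).IsHomogeneous e)
    (hrad : ∀ j, X j ∈ (Ideal.span (Set.range (A.mulVec X))).radical)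
    {k : ℕ} {p : MvPolynomial (Fin n) K} (hp : p.IsHomogeneous k)
    (hpX : ∀ j, p * X j ∈ Ideal.span (Set.range (A.mulVec X))) :
    ∃ c : K, p - C c * A.det ∈ Ideal.span (Set.range (A.mulVec X)) ∧ (k ≠ n * e → c = 0) := by
  set I := Ideal.span (Set.range (A.mulVec X))
  obtain ⟨q, hq, r, hr, hqr⟩ := Submodule.mem_sup.mp (mem_span_sup_span_det_of_mul_X_mem A hrad hpX)
  obtain ⟨c, rfl⟩ := Ideal.mem_span_singleton'.mp hr
  have hdet : A.det.IsHomogeneous (n * e) := by simpa using IsHomogeneous.det hA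
  have hqk := homogeneousComponent_mem_span_range (isHomogeneous_mulVec_X hA) hq k
  have hcomp := congrArg (homogeneousComponent k) hqr
  rw [map_add, homogeneousComponent_eq_self hp,
    homogeneousComponent_mul_of_isHomogeneous _ hdet] at hcomp
  rcases lt_trichotomy k (n * e) with h | rfl | h
  · rw [if_neg (by omega), add_zero] at hcomp
    exact ⟨0, by simpa [← hcomp] using hqk, fun _ => rfl⟩
  · rw [if_pos le_rfl, Nat.sub_self, homogeneousComponent_zero] at hcomp
    exact ⟨coeff 0 c, by simpa [← hcomp] using hqk, fun h => absurd rfl h⟩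
  · rw [if_pos h.le] at hcomp
    refine ⟨0, ?_, fun _ => rfl⟩
    rw [C_0, zero_mul, sub_zero, ← hcomp]
    refine add_mem hqk ?_
    have hmem : homogeneousComponent (k - n * e) c ∈ idealOfVars (Fin n) K :=
      Ideal.pow_le_self (by omega)
        (homogeneousComponent_isHomogeneous (k - n * e) c).mem_idealOfVars_pow
    have hle : idealOfVars (Fin n) K ≤ Submodule.comap (LinearMap.mulRight _ A.det) I := by
      rw [idealOfVars, Ideal.span_le]
      rintro _ ⟨j, rfl⟩
      simpa [mul_comm] using Matrix.det_mul_mem_span_range_mulVec A X j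
    exact hle hmem

theorem MvPolynomial.mem_span_of_lt_degree (hA : ∀ i j, (A i j).IsHomogeneous e)
    (hrad : ∀ j, X j ∈ (Ideal.span (Set.range (A.mulVec X))).radical)
    {k : ℕ} (hk : n * e < k ∨ A.det ∈ Ideal.span (Set.range (A.mulVec X)))
    {p : MvPolynomial (Fin n) K} (hp : p.IsHomogeneous k) :
    p ∈ Ideal.span (Set.range (A.mulVec X)) := by
  set I := Ideal.span (Set.range (A.mulVec X))
  obtain ⟨B, hB⟩ : ∃ B, idealOfVars (Fin n) K ^ B ≤ I :=
    Ideal.exists_pow_le_of_le_radical_of_fg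
      (Ideal.span_le.mpr (by rintro _ ⟨j, rfl⟩; exact hrad j)) (idealOfVars_fg _ _)
  by_cases hkB : B ≤ k
  · exact hB (Ideal.pow_le_pow_right hkB hp.mem_idealOfVars_pow)
  · push Not at hkB
    induction hr : B - k generalizing k p with
    | zero => omega
    | succ r ih =>
      have hpX (j : Fin n) : p * X j ∈ I := by
        have hpj := hp.mul (isHomogeneous_X K j)
        by_cases h : B ≤ k + 1
        · exact hB (Ideal.pow_le_pow_right h hpj.mem_idealOfVars_pow)
        · exact ih hpj (hk.imp_left (by omega)) (by omega) (by omega)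
      obtain ⟨c, hc, hc0⟩ := exists_sub_C_mul_det_mem hA hrad hp hpX
      rcases hk with hk | hk
      · simpa [hc0 hk.ne'] using hc
      · simpa using add_mem hc (I.mul_mem_left (C c) hk)

theorem MvPolynomial.det_notMem_span (hA : ∀ i j, (A i j).IsHomogeneous e)
    (hrad : ∀ j, X j ∈ (Ideal.span (Set.range (A.mulVec X))).radical) :
    A.det ∉ Ideal.span (Set.range (A.mulVec X)) := by
  intro h
  have hone := mem_span_of_lt_degree hA hrad (Or.inr h) (isHomogeneous_one (Fin n) K)
  have hle : Ideal.span (Set.range (A.mulVec X)) ≤ RingHom.ker (constantCoeff (R := K)) := by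
    rw [Ideal.span_le]
    rintro _ ⟨i, rfl⟩
    simp [Matrix.mulVec, dotProduct, RingHom.mem_ker]
  simpa [RingHom.mem_ker] using hle hone

end Homogeneous

theorem MvPolynomial.X_mem_radical_of_zeroLocus {K σ ι : Type*} [Field K] [IsAlgClosed K] [Finite σ]
    (f : ι → MvPolynomial σ K) (hzero : ∀ p : σ → K, (∀ i, eval p (f i) = 0) → p = 0) (j : σ) :
    X j ∈ (Ideal.span (Set.range f)).radical := by
  rw [← vanishingIdeal_zeroLocus_eq_radical (K := K), mem_vanishingIdeal_iff]
  intro x hx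
  have : x = 0 := hzero x fun i => by
    simpa [aeval_eq_eval] using hx (f i) (Ideal.subset_span ⟨i, rfl⟩)
  simp [this]

theorem MvPolynomial.mem_iSup_map_mulRight {σ ι R : Type*} [CommSemiring R] [Finite ι]
    {f : ι → MvPolynomial σ R} {r k : ℕ} (hf : ∀ i, (f i).IsHomogeneous r) (hrk : r ≤ k)
    {p : MvPolynomial σ R} :
    p ∈ ⨆ i, (homogeneousSubmodule σ R (k - r)).map (LinearMap.mulRight R (f i)) ↔
      p.IsHomogeneous k ∧ p ∈ Ideal.span (Set.range f) := by
  cases nonempty_fintype ι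
  constructor
  · intro hp
    have hle : ⨆ i, (homogeneousSubmodule σ R (k - r)).map (LinearMap.mulRight R (f i)) ≤
        homogeneousSubmodule σ R k ⊓ (Ideal.span (Set.range f)).restrictScalars R := by
      refine iSup_le fun i => ?_
      rintro _ ⟨q, hq, rfl⟩
      refine ⟨?_, Ideal.mul_mem_left _ q (Ideal.subset_span ⟨i, rfl⟩)⟩
      have := ((mem_homogeneousSubmodule _ _).mp hq).mul (hf i)
      rwa [Nat.sub_add_cancel hrk] at this
    exact hle hp
  · rintro ⟨hp, hpI⟩
    obtain ⟨c, hc⟩ := Ideal.mem_span_range_iff_exists_fun.mp hpI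
    rw [← homogeneousComponent_eq_self hp, ← hc, map_sum]
    refine sum_mem fun i _ => Submodule.mem_iSup_of_mem i ?_
    rw [homogeneousComponent_mul_of_isHomogeneous _ (hf i), if_pos hrk]
    exact ⟨_, homogeneousComponent_mem _ _, rfl⟩

/-- For `n ≥ 2`, `d ≥ 3` and homogeneous forms `f 1, …, f n` of degree `d - 1`
whose only common zero is the origin, the space of forms of degree `n(d-2)` is the direct sum
of `W_𝔣 = Σ_i ℂ[z]_{n(d-2)-(d-1)}·f_i` and the line spanned by the Jacobian `Jac 𝔣`;
in particular `W_𝔣` has codimension one (the Jacobian is nonzero). -/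
theorem homogeneous_component_eq_Wf_sup_span_jacobian
    (n d : ℕ) (hn : 2 ≤ n) (hd : 3 ≤ d)
    (f : Fin n → MvPolynomial (Fin n) ℂ)
    (hf : ∀ i, (f i).IsHomogeneous (d - 1))
    (hzero : ∀ p : Fin n → ℂ, (∀ i, eval p (f i) = 0) → p = 0) :
    letI jac : MvPolynomial (Fin n) ℂ :=
      Matrix.det (Matrix.of fun i j : Fin n => pderiv j (f i))
    letI W : Submodule ℂ (MvPolynomial (Fin n) ℂ) :=
      ⨆ i : Fin n, (homogeneousSubmodule (Fin n) ℂ (n * (d - 2) - (d - 1))).map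
        (LinearMap.mulRight ℂ (f i))
    homogeneousSubmodule (Fin n) ℂ (n * (d - 2)) = W ⊔ Submodule.span ℂ {jac}
      ∧ W ⊓ Submodule.span ℂ {jac} = ⊥
      ∧ jac ≠ 0 := by
  set A : Matrix (Fin n) (Fin n) (MvPolynomial (Fin n) ℂ) :=
    Matrix.of fun i j : Fin n => pderiv j (f i) with hAdef
  have hA (i j : Fin n) : (A i j).IsHomogeneous (d - 2) := (hf i).pderiv
  have hdeg : d - 1 ≤ n * (d - 2) :=
    le_trans (by omega) (Nat.mul_le_mul_right (d - 2) hn)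
  have hd0 : ((d - 1 : ℕ) : ℂ) ≠ 0 := Nat.cast_ne_zero.mpr (by omega)
  have hmul (i : Fin n) : A.mulVec X i = C ((d - 1 : ℕ) : ℂ) * f i := by
    have := (hf i).sum_X_mul_pderiv
    rw [nsmul_eq_mul] at this
    simpa [hAdef, Matrix.mulVec, dotProduct, mul_comm] using this
  have hspan : Ideal.span (Set.range (A.mulVec X)) = Ideal.span (Set.range f) := by
    refine le_antisymm (Ideal.span_le.mpr ?_) (Ideal.span_le.mpr ?_)
    · rintro _ ⟨i, rfl⟩
      rw [hmul]
      exact Ideal.mul_mem_left _ _ (Ideal.subset_span ⟨i, rfl⟩)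
    · rintro _ ⟨i, rfl⟩
      have : f i = C ((d - 1 : ℕ) : ℂ)⁻¹ * A.mulVec X i := by
        rw [hmul, ← mul_assoc, ← C_mul, inv_mul_cancel₀ hd0, C_1, one_mul]
      rw [this]
      exact Ideal.mul_mem_left _ _ (Ideal.subset_span ⟨i, rfl⟩)
  have hrad (j : Fin n) : X j ∈ (Ideal.span (Set.range (A.mulVec X))).radical := by
    rw [hspan]
    exact X_mem_radical_of_zeroLocus f hzero j
  have hnot := det_notMem_span hA hrad
  have hjac : A.det.IsHomogeneous (n * (d - 2)) := by simpa using IsHomogeneous.det hA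
  refine ⟨le_antisymm (fun p hp => ?_) (sup_le (fun p hp => ?_) ?_), ?_, ?_⟩
  · obtain ⟨c, hc, -⟩ := exists_sub_C_mul_det_mem hA hrad hp fun j =>
      mem_span_of_lt_degree hA hrad (Or.inl (Nat.lt_succ_self _))
        (((mem_homogeneousSubmodule _ _).mp hp).mul (isHomogeneous_X ℂ j))
    rw [hspan] at hc
    refine Submodule.mem_sup.mpr ⟨p - C c * A.det, (mem_iSup_map_mulRight hf hdeg).mpr ⟨?_, hc⟩,
      C c * A.det, Submodule.mem_span_singleton.mpr ⟨c, smul_eq_C_mul _ _⟩, sub_add_cancel _ _⟩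
    exact ((mem_homogeneousSubmodule _ _).mp hp).sub (hjac.C_mul c)
  · exact ((mem_iSup_map_mulRight hf hdeg).mp hp).1
  · rw [Submodule.span_singleton_le_iff_mem]
    exact hjac
  · rw [eq_bot_iff]
    rintro p ⟨hpW, hpJ⟩
    obtain ⟨c, rfl⟩ := Submodule.mem_span_singleton.mp hpJ
    have hcI := ((mem_iSup_map_mulRight hf hdeg).mp hpW).2
    rw [← hspan] at hcI
    by_cases hc : c = 0
    · simp [hc]
    · refine absurd ?_ hnot
      have := Submodule.smul_of_tower_mem _ c⁻¹ hcI
      rwa [smul_smul, inv_mul_cancel₀ hc, one_smul] at this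
  · intro h
    exact hnot (h ▸ zero_mem _)
end
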